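/- arXiv:1701.08690 — 3 statements merged into one kernel-verified Lean document; each statement's English description precedes it below -/
import Mathlib

section
/- Let n ≥ 1. Let W be a 3-dimensional real subspace of ℝ^{3+n} on which the bilinear form B_{3,n} is positive definite, let W_ℂ ⊆ ℂ^{3+n} be its complexification, and let Q_W = {[v] ∈ Ω_{3,n} : v ∈ W_ℂ} with the subspace topology. Then the inclusion map Q_W → Ω_{3,n} is a homotopy equivalence (i.e., there exists a continuous map Ω_{3,n} → Q_W that is a two-sided homotopy inverse of the inclusion). -/
open scoped BigOperators

noncomputable section

/-- The standard symmetric bilinear form of signature `(3, n)` on `ℝ^{3+n}`. -/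
def B3n (n : ℕ) (x y : Fin (n + 3) → ℝ) : ℝ :=
  ∑ i : Fin (n + 3), (if (i : ℕ) < 3 then (1 : ℝ) else -1) * x i * y i

/-- The complex-bilinear extension of `B3n` to `ℂ^{3+n}`. -/
def B3nC (n : ℕ) (v w : Fin (n + 3) → ℂ) : ℂ :=
  ∑ i : Fin (n + 3), (if (i : ℕ) < 3 then (1 : ℂ) else -1) * v i * w i

/-- Coordinatewise complex conjugation on `ℂ^{3+n}`. -/
def conjVec (n : ℕ) (v : Fin (n + 3) → ℂ) : Fin (n + 3) → ℂ :=
  fun i => (starRingEnd ℂ) (v i)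

/-- The quotient topology on a projectivization. -/
instance projectivizationTopology (K V : Type*) [DivisionRing K] [AddCommGroup V] [Module K V]
    [TopologicalSpace V] : TopologicalSpace (Projectivization K V) :=
  instTopologicalSpaceQuotient

/-- The period domain `Ω_{3,n}` : the set of lines `[v]` in `ℙ(ℂ^{3+n})` with
`B_ℂ(v,v) = 0` and `B_ℂ(v, v̄) > 0` (the latter quantity is automatically real,
so positivity is expressed via its real part). -/
def Omega (n : ℕ) : Set (Projectivization ℂ (Fin (n + 3) → ℂ)) :=
  {p | B3nC n p.rep p.rep = 0 ∧ 0 < (B3nC n p.rep (conjVec n p.rep)).re}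


/-- The complexification `W_ℂ ⊆ ℂ^{3+n}` of a real subspace `W ⊆ ℝ^{3+n}`:
the `ℂ`-span of the image of `W` under the coordinatewise inclusion `ℝ → ℂ`. -/
def complexify (n : ℕ) (W : Submodule ℝ (Fin (n + 3) → ℝ)) :
    Submodule ℂ (Fin (n + 3) → ℂ) :=
  Submodule.span ℂ ((fun x => fun i => (x i : ℂ)) '' (W : Set (Fin (n + 3) → ℝ)))

/-- The conic `Q_W ⊆ Ω_{3,n}` of isotropic lines in the complexification of `W`. -/
def QW (n : ℕ) (W : Submodule ℝ (Fin (n + 3) → ℝ)) :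
    Set (Projectivization ℂ (Fin (n + 3) → ℂ)) :=
  {p ∈ Omega n | p.rep ∈ complexify n W}

lemma QW_subset (n : ℕ) (W : Submodule ℝ (Fin (n + 3) → ℝ)) : QW n W ⊆ Omega n :=
  fun _ hp => hp.1

/-- The inclusion `Q_W → Ω_{3,n}` as a continuous map of subspaces. -/
def QWinclusion (n : ℕ) (W : Submodule ℝ (Fin (n + 3) → ℝ)) :
    C(↥(QW n W), ↥(Omega n)) :=
  ⟨Set.inclusion (QW_subset n W), continuous_inclusion (QW_subset n W)⟩

lemma B3n_comm (n : ℕ) (x y : Fin (n + 3) → ℝ) : B3n n x y = B3n n y x :=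
  Finset.sum_congr rfl fun _ _ => by ring

lemma B3n_add_left (n : ℕ) (x y z : Fin (n + 3) → ℝ) :
    B3n n (x + y) z = B3n n x z + B3n n y z := by
  simp only [B3n, ← Finset.sum_add_distrib, Pi.add_apply]
  exact Finset.sum_congr rfl fun _ _ => by ring

lemma B3n_smul_left (n : ℕ) (c : ℝ) (x y : Fin (n + 3) → ℝ) :
    B3n n (c • x) y = c * B3n n x y := by
  simp only [B3n, Finset.mul_sum, Pi.smul_apply, smul_eq_mul]
  exact Finset.sum_congr rfl fun _ _ => by ring

lemma B3n_add_right (n : ℕ) (x y z : Fin (n + 3) → ℝ) :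
    B3n n x (y + z) = B3n n x y + B3n n x z := by
  rw [B3n_comm, B3n_add_left, B3n_comm n y, B3n_comm n z]

lemma B3n_smul_right (n : ℕ) (c : ℝ) (x y : Fin (n + 3) → ℝ) :
    B3n n x (c • y) = c * B3n n x y := by
  rw [B3n_comm, B3n_smul_left, B3n_comm]

/-- The form `B3n` as a bundled bilinear form. -/
def bilin3n (n : ℕ) : LinearMap.BilinForm ℝ (Fin (n + 3) → ℝ) :=
  LinearMap.mk₂ ℝ (B3n n) (B3n_add_left n) (B3n_smul_left n) (B3n_add_right n) (B3n_smul_right n)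

lemma bilin3n_apply (n : ℕ) (x y : Fin (n + 3) → ℝ) : bilin3n n x y = B3n n x y := rfl

/-- The orthogonal complement of a positive definite three-dimensional subspace is negative
semidefinite. -/
lemma B3n_self_nonpos_of_orthogonal (n : ℕ) (W : Submodule ℝ (Fin (n + 3) → ℝ))
    (hdim : Module.finrank ℝ ↥W = 3) (hpos : ∀ x ∈ W, x ≠ 0 → 0 < B3n n x x)
    (x : Fin (n + 3) → ℝ) (hx : ∀ y ∈ W, B3n n y x = 0) : B3n n x x ≤ 0 := by
  by_contra! hxx
  let φ : (↥W × ℝ) →ₗ[ℝ] (Fin (n + 3) → ℝ) :=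
    W.subtype.coprod (LinearMap.toSpanSingleton ℝ _ x)
  let ψ : (Fin (n + 3) → ℝ) →ₗ[ℝ] (Fin 3 → ℝ) :=
    LinearMap.funLeft ℝ ℝ (Fin.castLE (Nat.le_add_left 3 n))
  have hker : LinearMap.ker (ψ ∘ₗ φ) ≠ ⊥ :=
    LinearMap.ker_ne_bot_of_finrank_lt (by simp [hdim])
  obtain ⟨⟨w, c⟩, hwc, hne⟩ := (Submodule.ne_bot_iff _).mp hker
  have hzero : ∀ i : Fin (n + 3), (i : ℕ) < 3 → ((w : Fin (n + 3) → ℝ) + c • x) i = 0 := by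
    intro i hi
    have := congrFun (LinearMap.mem_ker.mp hwc) ⟨i, hi⟩
    simpa [φ, ψ, LinearMap.funLeft] using this
  have hnonpos : B3n n ((w : Fin (n + 3) → ℝ) + c • x) (w + c • x) ≤ 0 := by
    refine Finset.sum_nonpos fun i _ => ?_
    split_ifs with hi
    · simp [hzero i hi]
    · nlinarith [mul_self_nonneg (((w : Fin (n + 3) → ℝ) + c • x) i)]
  have hexp : B3n n ((w : Fin (n + 3) → ℝ) + c • x) (w + c • x)
      = B3n n w w + c * c * B3n n x x := by
    simp only [B3n_add_left, B3n_add_right, B3n_smul_left, B3n_smul_right, B3n_comm n x w,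
      hx w w.2]
    ring
  rw [hexp] at hnonpos
  by_cases hw : w = 0
  · have hc : c ≠ 0 := fun hc => hne (by simp [hw, hc])
    have h0 : B3n n ((w : ↥W) : Fin (n + 3) → ℝ) w = 0 := by simp [hw, B3n]
    nlinarith [mul_pos (mul_self_pos.mpr hc) hxx]
  · have := hpos w w.2 (by simpa using hw)
    nlinarith [mul_nonneg (mul_self_nonneg c) hxx.le]

/-- The `B3n`-orthogonal projection onto a positive definite subspace. -/
lemma exists_orthogonal_projection (n : ℕ) (W : Submodule ℝ (Fin (n + 3) → ℝ))
    (hpos : ∀ x ∈ W, x ≠ 0 → 0 < B3n n x x) :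
    ∃ P : (Fin (n + 3) → ℝ) →ₗ[ℝ] (Fin (n + 3) → ℝ),
      (∀ x, P x ∈ W) ∧ (∀ x ∈ W, P x = x) ∧ ∀ x, ∀ y ∈ W, B3n n y (x - P x) = 0 := by
  have hrefl : (bilin3n n).IsRefl := fun x y h => by
    rwa [bilin3n_apply, B3n_comm] at h
  have hdef : ∀ w : ↥W, B3n n w w = 0 → w = 0 := fun w hw => by
    by_contra hne
    exact (hpos w w.2 (by simpa using hne)).ne' hw
  have hnondeg : ((bilin3n n).restrict W).Nondegenerate :=
    ⟨fun w hw => hdef w (hw w), fun w hw => hdef w (hw w)⟩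
  have hcompl := LinearMap.BilinForm.isCompl_orthogonal_of_restrict_nondegenerate hrefl hnondeg
  refine ⟨W.projection _ hcompl, Submodule.projection_apply_mem hcompl,
    fun x hx => Submodule.projection_apply_of_mem_left hcompl hx, fun x y hy => ?_⟩
  exact Submodule.sub_projection_mem hcompl x y hy

/-- Coordinatewise real part. -/
def reVec (n : ℕ) (v : Fin (n + 3) → ℂ) : Fin (n + 3) → ℝ := fun i => (v i).re

/-- Coordinatewise imaginary part. -/
def imVec (n : ℕ) (v : Fin (n + 3) → ℂ) : Fin (n + 3) → ℝ := fun i => (v i).im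

lemma reVec_smul (n : ℕ) (c : ℂ) (v : Fin (n + 3) → ℂ) :
    reVec n (c • v) = c.re • reVec n v - c.im • imVec n v := by
  ext i; simp [reVec, imVec]

lemma imVec_smul (n : ℕ) (c : ℂ) (v : Fin (n + 3) → ℂ) :
    imVec n (c • v) = c.re • imVec n v + c.im • reVec n v := by
  ext i; simp [reVec, imVec]

lemma mem_complexify_iff (n : ℕ) (W : Submodule ℝ (Fin (n + 3) → ℝ)) (v : Fin (n + 3) → ℂ) :
    v ∈ complexify n W ↔ reVec n v ∈ W ∧ imVec n v ∈ W := by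
  constructor
  · intro hv
    induction hv using Submodule.span_induction with
    | mem v hv =>
      obtain ⟨x, hx, rfl⟩ := hv
      exact ⟨hx, W.zero_mem⟩
    | zero => exact ⟨W.zero_mem, W.zero_mem⟩
    | add v w _ _ hv hw => exact ⟨W.add_mem hv.1 hw.1, W.add_mem hv.2 hw.2⟩
    | smul c v _ hv =>
      rw [reVec_smul, imVec_smul]
      exact ⟨W.sub_mem (W.smul_mem _ hv.1) (W.smul_mem _ hv.2),
        W.add_mem (W.smul_mem _ hv.2) (W.smul_mem _ hv.1)⟩
  · rintro ⟨hre, him⟩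
    have hv : v = (fun i => (reVec n v i : ℂ)) + Complex.I • fun i => (imVec n v i : ℂ) := by
      ext i
      simpa [reVec, imVec, mul_comm] using (Complex.re_add_im (v i)).symm
    rw [hv]
    exact Submodule.add_mem _ (Submodule.subset_span ⟨_, hre, rfl⟩)
      (Submodule.smul_mem _ _ (Submodule.subset_span ⟨_, him, rfl⟩))

/-- The complex-linear extension of a real-linear endomorphism. -/
def complexExtend (n : ℕ) (P : (Fin (n + 3) → ℝ) →ₗ[ℝ] (Fin (n + 3) → ℝ)) :
    (Fin (n + 3) → ℂ) →ₗ[ℂ] (Fin (n + 3) → ℂ) where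
  toFun v := fun i => ⟨P (reVec n v) i, P (imVec n v) i⟩
  map_add' v w := by
    have hre : reVec n (v + w) = reVec n v + reVec n w := rfl
    have him : imVec n (v + w) = imVec n v + imVec n w := rfl
    ext i
    apply Complex.ext <;> simp [hre, him]
  map_smul' c v := by
    ext i
    apply Complex.ext <;> simp [reVec_smul, imVec_smul]

lemma B3nC_re (n : ℕ) (v w : Fin (n + 3) → ℂ) :
    (B3nC n v w).re = B3n n (reVec n v) (reVec n w) - B3n n (imVec n v) (imVec n w) := by
  simp only [B3nC, B3n, Complex.re_sum, ← Finset.sum_sub_distrib]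
  refine Finset.sum_congr rfl fun i _ => ?_
  split_ifs
  · simp [reVec, imVec]
  · simp [reVec, imVec]; ring

lemma B3nC_im (n : ℕ) (v w : Fin (n + 3) → ℂ) :
    (B3nC n v w).im = B3n n (reVec n v) (imVec n w) + B3n n (imVec n v) (reVec n w) := by
  simp only [B3nC, B3n, Complex.im_sum, ← Finset.sum_add_distrib]
  refine Finset.sum_congr rfl fun i _ => ?_
  split_ifs
  · simp [reVec, imVec]
  · simp [reVec, imVec]; ring

lemma reVec_conjVec (n : ℕ) (v : Fin (n + 3) → ℂ) : reVec n (conjVec n v) = reVec n v := rfl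

lemma imVec_conjVec (n : ℕ) (v : Fin (n + 3) → ℂ) :
    imVec n (conjVec n v) = (-1 : ℝ) • imVec n v := by
  ext i; simp [imVec, conjVec]

lemma conjVec_add (n : ℕ) (v w : Fin (n + 3) → ℂ) :
    conjVec n (v + w) = conjVec n v + conjVec n w := by
  ext i; simp [conjVec]

lemma conjVec_smul (n : ℕ) (c : ℂ) (v : Fin (n + 3) → ℂ) :
    conjVec n (c • v) = starRingEnd ℂ c • conjVec n v := by
  ext i; simp [conjVec]

lemma conjVec_conjVec (n : ℕ) (v : Fin (n + 3) → ℂ) : conjVec n (conjVec n v) = v := by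
  ext i; simp [conjVec]

lemma B3nC_comm (n : ℕ) (v w : Fin (n + 3) → ℂ) : B3nC n v w = B3nC n w v :=
  Finset.sum_congr rfl fun _ _ => by ring

lemma B3nC_add_left (n : ℕ) (u v w : Fin (n + 3) → ℂ) :
    B3nC n (u + v) w = B3nC n u w + B3nC n v w := by
  simp only [B3nC, ← Finset.sum_add_distrib, Pi.add_apply]
  exact Finset.sum_congr rfl fun _ _ => by ring

lemma B3nC_smul_left (n : ℕ) (c : ℂ) (v w : Fin (n + 3) → ℂ) :
    B3nC n (c • v) w = c * B3nC n v w := by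
  simp only [B3nC, Finset.mul_sum, Pi.smul_apply, smul_eq_mul]
  exact Finset.sum_congr rfl fun _ _ => by ring

lemma B3nC_add_right (n : ℕ) (u v w : Fin (n + 3) → ℂ) :
    B3nC n u (v + w) = B3nC n u v + B3nC n u w := by
  rw [B3nC_comm, B3nC_add_left, B3nC_comm n v, B3nC_comm n w]

lemma B3nC_smul_right (n : ℕ) (c : ℂ) (v w : Fin (n + 3) → ℂ) :
    B3nC n v (c • w) = c * B3nC n v w := by
  rw [B3nC_comm, B3nC_smul_left, B3nC_comm]

lemma B3nC_conjVec_conjVec (n : ℕ) (v w : Fin (n + 3) → ℂ) :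
    B3nC n (conjVec n v) (conjVec n w) = starRingEnd ℂ (B3nC n v w) := by
  simp only [B3nC, map_sum, conjVec]
  refine Finset.sum_congr rfl fun i _ => ?_
  split_ifs <;> simp

/-- The value `B_ℂ(v, v̄)`, as a real number. -/
def hermNorm (n : ℕ) (v : Fin (n + 3) → ℂ) : ℝ := (B3nC n v (conjVec n v)).re

lemma B3nC_conjVec_right (n : ℕ) (v : Fin (n + 3) → ℂ) :
    B3nC n v (conjVec n v) = (hermNorm n v : ℂ) := by
  apply Complex.ext
  · rfl
  · rw [B3nC_im, reVec_conjVec, imVec_conjVec, B3n_smul_right, B3n_comm n (imVec n v)]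
    simp

lemma hermNorm_eq (n : ℕ) (v : Fin (n + 3) → ℂ) :
    hermNorm n v = B3n n (reVec n v) (reVec n v) + B3n n (imVec n v) (imVec n v) := by
  rw [hermNorm, B3nC_re, reVec_conjVec, imVec_conjVec, B3n_smul_right]
  ring

lemma hermNorm_smul (n : ℕ) (c : ℂ) (v : Fin (n + 3) → ℂ) :
    hermNorm n (c • v) = Complex.normSq c * hermNorm n v := by
  have h := B3nC_conjVec_right n (c • v)
  rw [conjVec_smul, B3nC_smul_left, B3nC_smul_right, B3nC_conjVec_right, ← mul_assoc,
    Complex.mul_conj] at h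
  exact_mod_cast h.symm

lemma continuous_B3nC_self (n : ℕ) : Continuous fun v : Fin (n + 3) → ℂ => B3nC n v v := by
  unfold B3nC; fun_prop

lemma continuous_conjVec (n : ℕ) : Continuous (conjVec n) :=
  continuous_pi fun i => Complex.continuous_conj.comp (continuous_apply i)

lemma continuous_hermNorm (n : ℕ) : Continuous (hermNorm n) := by
  have := continuous_conjVec n
  unfold hermNorm B3nC
  fun_prop

/-- If the real span of the real and imaginary parts of `u` is negative semidefinite, then
`|B(u, u)| ≤ -B(u, ū)`. -/
lemma norm_B3nC_self_le (n : ℕ) (u : Fin (n + 3) → ℂ)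
    (hu : ∀ a b : ℝ, B3n n (a • reVec n u + b • imVec n u) (a • reVec n u + b • imVec n u) ≤ 0) :
    ‖B3nC n u u‖ ≤ -hermNorm n u := by
  set X := B3n n (reVec n u) (reVec n u) with hX
  set Y := B3n n (imVec n u) (imVec n u) with hY
  set Z := B3n n (reVec n u) (imVec n u) with hZ
  have hquad : ∀ a b : ℝ, a * a * X + 2 * a * b * Z + b * b * Y ≤ 0 := fun a b => by
    have := hu a b
    simp only [B3n_add_left, B3n_add_right, B3n_smul_left, B3n_smul_right,
      B3n_comm n (imVec n u) (reVec n u), ← hX, ← hY, ← hZ] at this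
    linarith
  have hXn : X ≤ 0 := by simpa using hquad 1 0
  have hYn : Y ≤ 0 := by simpa using hquad 0 1
  have hdisc : Z * Z ≤ X * Y := by
    have h := discrim_le_zero (a := -X) (b := -2 * Z) (c := -Y)
      (fun a => by nlinarith [hquad a 1])
    unfold discrim at h
    linarith
  rw [hermNorm_eq, ← hX, ← hY]
  refine (sq_le_sq₀ (norm_nonneg _) (by linarith)).mp ?_
  rw [Complex.sq_norm, Complex.normSq_apply, B3nC_re, B3nC_im, B3n_comm n (imVec n u) (reVec n u),
    ← hX, ← hY, ← hZ]
  nlinarith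

/-- Replaces `v` by an isotropic vector spanning, with its conjugate, the same complex plane
as `v` and `v̄`. -/
def isotropize (n : ℕ) (v : Fin (n + 3) → ℂ) : Fin (n + 3) → ℂ :=
  ((hermNorm n v + √(hermNorm n v ^ 2 - Complex.normSq (B3nC n v v)) : ℝ) : ℂ) • v +
    (-B3nC n v v) • conjVec n v

lemma continuous_isotropize (n : ℕ) : Continuous (isotropize n) := by
  have h₁ := continuous_hermNorm n
  have h₂ := continuous_B3nC_self n
  have h₃ := continuous_conjVec n
  have h₄ := Complex.continuous_normSq.comp h₂
  exact ((Complex.continuous_ofReal.comp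
    (h₁.add ((h₁.pow 2).sub h₄).sqrt)).smul continuous_id).add (h₂.neg.smul h₃)

lemma isotropize_smul (n : ℕ) (c : ℂ) (v : Fin (n + 3) → ℂ) :
    isotropize n (c • v) = ((Complex.normSq c : ℂ) * c) • isotropize n v := by
  have hq : B3nC n (c • v) (c • v) = c * (c * B3nC n v v) := by
    rw [B3nC_smul_left, B3nC_smul_right]
  have hs : √(hermNorm n (c • v) ^ 2 - Complex.normSq (B3nC n (c • v) (c • v)))
      = Complex.normSq c * √(hermNorm n v ^ 2 - Complex.normSq (B3nC n v v)) := by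
    rw [hq, hermNorm_smul, Complex.normSq_mul, Complex.normSq_mul,
      ← Real.sqrt_sq (Complex.normSq_nonneg c), ← Real.sqrt_mul (sq_nonneg _),
      Real.sqrt_sq (Complex.normSq_nonneg c)]
    congr 1
    ring
  unfold isotropize
  rw [hs, hq, hermNorm_smul, conjVec_smul, smul_add, smul_smul, smul_smul, smul_smul, smul_smul]
  congr 2
  · push_cast; ring
  · rw [← Complex.mul_conj]; ring

/-- The cone of vectors spanning the lines in the period domain. -/
def periodCone (n : ℕ) : Set (Fin (n + 3) → ℂ) :=
  {v | B3nC n v v = 0 ∧ 0 < hermNorm n v}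

lemma isotropize_of_mem_periodCone (n : ℕ) {v : Fin (n + 3) → ℂ} (hv : v ∈ periodCone n) :
    isotropize n v = ((2 * hermNorm n v : ℝ) : ℂ) • v := by
  rw [isotropize, hv.1]
  simp [Real.sqrt_sq hv.2.le, two_mul]

lemma isotropize_mem_periodCone (n : ℕ) {v : Fin (n + 3) → ℂ}
    (hv : ‖B3nC n v v‖ < hermNorm n v) : isotropize n v ∈ periodCone n := by
  set h := hermNorm n v with hh
  set q := B3nC n v v with hq
  set s := √(h ^ 2 - Complex.normSq q) with hs
  have hlt : 0 < h ^ 2 - Complex.normSq q := by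
    rw [← Complex.sq_norm]
    nlinarith [norm_nonneg q]
  have hh0 : 0 < h := (norm_nonneg q).trans_lt hv
  have hs0 : 0 < s := Real.sqrt_pos.mpr hlt
  have hsq : s ^ 2 = h ^ 2 - Complex.normSq q := Real.sq_sqrt hlt.le
  have hnq : Complex.normSq q = h ^ 2 - s ^ 2 := by linarith
  have hqq : q * starRingEnd ℂ q = (h : ℂ) ^ 2 - (s : ℂ) ^ 2 := by
    rw [Complex.mul_conj, hnq]; push_cast; ring
  have hv' : isotropize n v = ((h + s : ℝ) : ℂ) • v + (-q) • conjVec n v := rfl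
  have hcomm : B3nC n (conjVec n v) v = (h : ℂ) := by rw [B3nC_comm, B3nC_conjVec_right]
  constructor
  · rw [hv']
    simp only [B3nC_add_left, B3nC_add_right, B3nC_smul_left, B3nC_smul_right, hcomm,
      B3nC_conjVec_right, B3nC_conjVec_conjVec, ← hq, ← hh]
    push_cast
    linear_combination q * hqq
  · have key : ((hermNorm n (isotropize n v) : ℝ) : ℂ) = ((2 * s ^ 2 * (h + s) : ℝ) : ℂ) := by
      rw [← B3nC_conjVec_right, hv']
      simp only [B3nC_add_left, B3nC_add_right, B3nC_smul_left, B3nC_smul_right, hcomm,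
        B3nC_conjVec_right, B3nC_conjVec_conjVec, conjVec_add, conjVec_smul, conjVec_conjVec,
        map_neg, Complex.conj_ofReal, ← hq, ← hh]
      push_cast
      linear_combination (-(h : ℂ) - 2 * s) * hqq
    rw [Complex.ofReal_inj.mp key]
    positivity

lemma ne_zero_of_mem_periodCone (n : ℕ) {v : Fin (n + 3) → ℂ} (hv : v ∈ periodCone n) :
    v ≠ 0 := by
  rintro rfl
  have := hv.2
  simp [hermNorm, B3nC] at this

lemma smul_mem_periodCone_iff (n : ℕ) {c : ℂ} (hc : c ≠ 0) (v : Fin (n + 3) → ℂ) :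
    c • v ∈ periodCone n ↔ v ∈ periodCone n := by
  simp only [periodCone, Set.mem_ofPred_eq, hermNorm_smul, B3nC_smul_left, B3nC_smul_right,
    mul_eq_zero, hc, false_or, mul_pos_iff_of_pos_left (Complex.normSq_pos.mpr hc)]

lemma mk_mem_Omega_iff (n : ℕ) (v : Fin (n + 3) → ℂ) (hv : v ≠ 0) :
    Projectivization.mk ℂ v hv ∈ Omega n ↔ v ∈ periodCone n := by
  obtain ⟨a, ha⟩ := Projectivization.exists_smul_eq_mk_rep ℂ v hv
  rw [← smul_mem_periodCone_iff n a.ne_zero v]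
  change (Projectivization.mk ℂ v hv).rep ∈ periodCone n ↔ _
  rw [← ha]
  rfl

lemma mk_mem_QW_iff (n : ℕ) (W : Submodule ℝ (Fin (n + 3) → ℝ)) (v : Fin (n + 3) → ℂ)
    (hv : v ≠ 0) :
    Projectivization.mk ℂ v hv ∈ QW n W ↔ v ∈ periodCone n ∧ v ∈ complexify n W := by
  obtain ⟨a, ha⟩ := Projectivization.exists_smul_eq_mk_rep ℂ v hv
  rw [← mk_mem_Omega_iff n v hv, ← Submodule.smul_mem_iff (complexify n W) a.ne_zero]
  change _ ∧ _ ↔ _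
  rw [← ha]
  rfl

/-- The quotient map from `ℂ^{3+n}` without the origin to its projectivization is open. -/
lemma isOpenMap_projectivization_mk' (n : ℕ) :
    IsOpenMap (Projectivization.mk' ℂ : {v : Fin (n + 3) → ℂ // v ≠ 0} → _) := by
  intro U hU
  change IsOpen ((Projectivization.mk' ℂ : {v : Fin (n + 3) → ℂ // v ≠ 0} → _) ⁻¹' _)
  have heq : (Projectivization.mk' ℂ : {v : Fin (n + 3) → ℂ // v ≠ 0} → _) ⁻¹'
      (Projectivization.mk' ℂ '' U) =
      ⋃ a : ℂˣ, (fun v : {v : Fin (n + 3) → ℂ // v ≠ 0} =>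
        (⟨(a : ℂ) • v.1, smul_ne_zero a.ne_zero v.2⟩ : {v : Fin (n + 3) → ℂ // v ≠ 0})) ⁻¹' U := by
    ext v
    simp only [Set.mem_preimage, Set.mem_image, Set.mem_iUnion]
    constructor
    · rintro ⟨w, hw, hwv⟩
      obtain ⟨a, ha⟩ := (Projectivization.mk_eq_mk_iff ℂ w.1 v.1 w.2 v.2).mp hwv
      refine ⟨a, ?_⟩
      convert hw
      exact ha
    · rintro ⟨a, ha⟩
      exact ⟨_, ha, (Projectivization.mk_eq_mk_iff ℂ _ _ _ v.2).mpr ⟨a, rfl⟩⟩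
  rw [heq]
  exact isOpen_iUnion fun a => hU.preimage (by fun_prop)

/-- The map from the period cone to the period domain sending a vector to its line. -/
def periodLine (n : ℕ) (v : periodCone n) : Omega n :=
  ⟨Projectivization.mk ℂ v.1 (ne_zero_of_mem_periodCone n v.2),
    (mk_mem_Omega_iff n _ _).mpr v.2⟩

lemma continuous_periodLine (n : ℕ) : Continuous (periodLine n) := by
  refine Continuous.subtype_mk ?_ _
  have hmk : Continuous (Projectivization.mk' ℂ : {v : Fin (n + 3) → ℂ // v ≠ 0} → _) :=
    continuous_quotient_mk'
  exact hmk.comp (continuous_subtype_val.subtype_mk fun v => ne_zero_of_mem_periodCone n v.2)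

lemma rep_mem_periodCone (n : ℕ) (p : Omega n) : p.1.rep ∈ periodCone n := p.2

lemma periodLine_rep (n : ℕ) (p : Omega n) :
    periodLine n ⟨p.1.rep, rep_mem_periodCone n p⟩ = p :=
  Subtype.ext p.1.mk_rep

lemma periodLine_eq_iff (n : ℕ) (v w : periodCone n) :
    periodLine n v = periodLine n w ↔ ∃ a : ℂ, a • w.1 = v.1 := by
  rw [Subtype.ext_iff]
  exact Projectivization.mk_eq_mk_iff' ℂ _ _ _ _

lemma isOpenQuotientMap_periodLine (n : ℕ) : IsOpenQuotientMap (periodLine n) := by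
  refine ⟨fun p => ⟨_, periodLine_rep n p⟩, continuous_periodLine n, ?_⟩
  rintro _ ⟨U, hU, rfl⟩
  refine ⟨_, isOpenMap_projectivization_mk' n _ (hU.preimage continuous_subtype_val), ?_⟩
  ext p
  constructor
  · rintro ⟨v, hv, hvp⟩
    have hcone : v.1 ∈ periodCone n := by
      rw [← mk_mem_Omega_iff n v.1 v.2]
      exact (congrArg (· ∈ Omega n) hvp).mpr p.2
    exact ⟨⟨v.1, hcone⟩, hv, Subtype.ext hvp⟩
  · rintro ⟨v, hv, rfl⟩
    exact ⟨⟨v.1, ne_zero_of_mem_periodCone n v.2⟩, hv, rfl⟩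

/-- A jointly continuous family of homogeneous self-maps of the period cone descends to a
jointly continuous family of self-maps of the period domain. -/
lemma continuous_descend {T : Type*} [TopologicalSpace T] (n : ℕ)
    (f : T × periodCone n → periodCone n) (hf : Continuous f)
    (hhom : ∀ t v w, (∃ a : ℂ, a • w.1 = v.1) → ∃ a : ℂ, a • (f (t, w)).1 = (f (t, v)).1) :
    Continuous fun x : T × Omega n =>
      periodLine n (f (x.1, ⟨x.2.1.rep, rep_mem_periodCone n x.2⟩)) := by
  have hquot := (IsOpenQuotientMap.id (X := T)).prodMap (isOpenQuotientMap_periodLine n)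
  rw [← hquot.continuous_comp_iff]
  convert (continuous_periodLine n).comp hf using 1
  ext1 ⟨t, v⟩
  refine (periodLine_eq_iff n _ _).mpr (hhom t _ _ ?_)
  exact (periodLine_eq_iff n _ _).mp (periodLine_rep n (periodLine n v))

/-- The path from the projection `P v` to `v`. -/
def projPath (n : ℕ) (P : (Fin (n + 3) → ℝ) →ₗ[ℝ] (Fin (n + 3) → ℝ)) (t : ℝ)
    (v : Fin (n + 3) → ℂ) : Fin (n + 3) → ℂ :=
  complexExtend n P v + (t : ℂ) • (v - complexExtend n P v)

lemma projPath_smul (n : ℕ) (P : (Fin (n + 3) → ℝ) →ₗ[ℝ] (Fin (n + 3) → ℝ)) (t : ℝ) (c : ℂ)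
    (v : Fin (n + 3) → ℂ) : projPath n P t (c • v) = c • projPath n P t v := by
  simp only [projPath, map_smul]
  module

lemma continuous_projPath (n : ℕ) (P : (Fin (n + 3) → ℝ) →ₗ[ℝ] (Fin (n + 3) → ℝ)) :
    Continuous fun x : ℝ × (Fin (n + 3) → ℂ) => projPath n P x.1 x.2 := by
  have : Continuous (complexExtend n P) := LinearMap.continuous_of_finiteDimensional _
  unfold projPath
  fun_prop

lemma norm_B3nC_projPath_lt (n : ℕ) (W : Submodule ℝ (Fin (n + 3) → ℝ))
    (hdim : Module.finrank ℝ ↥W = 3) (hpos : ∀ x ∈ W, x ≠ 0 → 0 < B3n n x x)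
    (P : (Fin (n + 3) → ℝ) →ₗ[ℝ] (Fin (n + 3) → ℝ)) (hPW : ∀ x, P x ∈ W)
    (hPorth : ∀ x, ∀ y ∈ W, B3n n y (x - P x) = 0) (t : ℝ) (ht₀ : 0 ≤ t) (ht₁ : t ≤ 1)
    (v : Fin (n + 3) → ℂ) (hv : v ∈ periodCone n) :
    ‖B3nC n (projPath n P t v) (projPath n P t v)‖ < hermNorm n (projPath n P t v) := by
  set w := complexExtend n P v with hw
  set u := v - w with hu
  have hure : reVec n u = reVec n v - P (reVec n v) := rfl
  have huim : imVec n u = imVec n v - P (imVec n v) := rfl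
  have horth : ∀ z, reVec n z ∈ W → imVec n z ∈ W → B3nC n z u = 0 := fun z hre him => by
    apply Complex.ext
    · simp [B3nC_re, hure, huim, hPorth _ _ hre, hPorth _ _ him]
    · simp [B3nC_im, hure, huim, hPorth _ _ hre, hPorth _ _ him]
  have hwu : B3nC n w u = 0 := horth w (hPW _) (hPW _)
  have hwu' : B3nC n (conjVec n w) u = 0 := by
    refine horth _ (hPW _) ?_
    rw [imVec_conjVec]
    exact W.smul_mem _ (hPW _)
  have hwu'' : B3nC n w (conjVec n u) = 0 := by
    have h := B3nC_conjVec_conjVec n (conjVec n w) u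
    rwa [conjVec_conjVec, hwu', map_zero] at h
  have hneg : ‖B3nC n u u‖ ≤ -hermNorm n u := by
    refine norm_B3nC_self_le n u fun a b =>
      B3n_self_nonpos_of_orthogonal n W hdim hpos _ fun y hy => ?_
    rw [B3n_add_right, B3n_smul_right, B3n_smul_right, hure, huim, hPorth _ _ hy, hPorth _ _ hy]
    ring
  have hB : ∀ r : ℝ, B3nC n (w + (r : ℂ) • u) (w + (r : ℂ) • u)
      = B3nC n w w + r ^ 2 * B3nC n u u := fun r => by
    simp only [B3nC_add_left, B3nC_add_right, B3nC_smul_left, B3nC_smul_right,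
      B3nC_comm n u w, hwu]
    ring
  have hH : ∀ r : ℝ, hermNorm n (w + (r : ℂ) • u) = hermNorm n w + r ^ 2 * hermNorm n u :=
    fun r => by
      have h := B3nC_conjVec_right n (w + (r : ℂ) • u)
      simp only [conjVec_add, conjVec_smul, B3nC_add_left, B3nC_add_right, B3nC_smul_left,
        B3nC_smul_right, B3nC_comm n u (conjVec n w), hwu', hwu'', B3nC_conjVec_right,
        Complex.conj_ofReal] at h
      apply Complex.ofReal_injective
      rw [← h]
      push_cast
      ring
  have hsum : w + ((1 : ℝ) : ℂ) • u = v := by simp [hu]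
  have hB1 := hB 1
  have hH1 := hH 1
  rw [hsum] at hB1 hH1
  rw [hv.1] at hB1
  have hv2 := hv.2
  have hww : B3nC n w w = -B3nC n u u := by
    push_cast at hB1
    linear_combination -hB1
  have hnorm : ‖B3nC n (w + (t : ℂ) • u) (w + (t : ℂ) • u)‖ = (1 - t ^ 2) * ‖B3nC n u u‖ := by
    have ht2 : 0 ≤ 1 - t ^ 2 := by nlinarith
    rw [hB, hww, show -B3nC n u u + (t : ℂ) ^ 2 * B3nC n u u
      = ((-(1 - t ^ 2) : ℝ) : ℂ) * B3nC n u u by push_cast; ring, norm_mul, Complex.norm_real,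
      norm_neg, Real.norm_of_nonneg ht2]
  change ‖B3nC n (w + (t : ℂ) • u) (w + (t : ℂ) • u)‖ < hermNorm n (w + (t : ℂ) • u)
  rw [hnorm, hH]
  nlinarith [mul_le_mul_of_nonneg_left hneg (show 0 ≤ 1 - t ^ 2 by nlinarith)]

/-- If `W` is a three-dimensional subspace of `ℝ^{3+n}` on which the
signature `(3,n)` form is positive definite, then the inclusion of the conic `Q_W`
into the period domain `Ω_{3,n}` is a homotopy equivalence: there is a continuous map
`Ω_{3,n} → Q_W` which is a two-sided homotopy inverse of the inclusion. -/
theorem QW_inclusion_homotopyEquiv (n : ℕ) (hn : 1 ≤ n)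
    (W : Submodule ℝ (Fin (n + 3) → ℝ))
    (hdim : Module.finrank ℝ ↥W = 3)
    (hpos : ∀ x ∈ W, x ≠ 0 → 0 < B3n n x x) :
    ∃ g : C(↥(Omega n), ↥(QW n W)),
      ContinuousMap.Homotopic ((QWinclusion n W).comp g) (ContinuousMap.id ↥(Omega n)) ∧
      ContinuousMap.Homotopic (g.comp (QWinclusion n W)) (ContinuousMap.id ↥(QW n W)) := by
  obtain ⟨P, hPW, hPid, hPorth⟩ := exists_orthogonal_projection n W hpos
  let f : unitInterval × periodCone n → periodCone n := fun x =>
    ⟨isotropize n (projPath n P x.1 x.2), isotropize_mem_periodCone n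
      (norm_B3nC_projPath_lt n W hdim hpos P hPW hPorth x.1 x.1.2.1 x.1.2.2 x.2 x.2.2)⟩
  have hf : Continuous f := by
    refine Continuous.subtype_mk ((continuous_isotropize n).comp
      ((continuous_projPath n P).comp (f := fun x : unitInterval × periodCone n =>
        ((x.1 : ℝ), (x.2 : Fin (n + 3) → ℂ))) ?_)) _
    fun_prop
  let H : unitInterval × Omega n → Omega n := fun x =>
    periodLine n (f (x.1, ⟨x.2.1.rep, rep_mem_periodCone n x.2⟩))
  have hH : Continuous H := by
    refine continuous_descend n f hf ?_
    rintro t v w ⟨a, ha⟩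
    refine ⟨(Complex.normSq a : ℂ) * a, ?_⟩
    simp only [f, ← ha, projPath_smul, isotropize_smul]
  have hfix : ∀ (t : unitInterval) p, projPath n P t p.1.rep = p.1.rep → H (t, p) = p := by
    intro t p hp
    conv_rhs => rw [← periodLine_rep n p]
    refine (periodLine_eq_iff n _ _).mpr ⟨((2 * hermNorm n p.1.rep : ℝ) : ℂ), ?_⟩
    simp only [f, hp]
    exact (isotropize_of_mem_periodCone n (rep_mem_periodCone n p)).symm
  have hone : ∀ p, H (1, p) = p := fun p => hfix 1 p (by simp [projPath])
  have hmem : ∀ p, (H (0, p)).1 ∈ QW n W := by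
    intro p
    refine (mk_mem_QW_iff n W _ _).mpr ⟨(f (0, _)).2, ?_⟩
    have hproj : complexExtend n P p.1.rep ∈ complexify n W :=
      (mem_complexify_iff n W _).mpr ⟨hPW _, hPW _⟩
    have hconj : conjVec n (complexExtend n P p.1.rep) ∈ complexify n W := by
      rw [mem_complexify_iff, imVec_conjVec]
      exact ⟨hPW _, W.smul_mem _ (hPW _)⟩
    simp only [f, projPath, Set.Icc.coe_zero, Complex.ofReal_zero, zero_smul, add_zero]
    exact Submodule.add_mem _ (Submodule.smul_mem _ _ hproj) (Submodule.smul_mem _ _ hconj)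
  let g : C(↥(Omega n), ↥(QW n W)) :=
    ⟨fun p => ⟨(H (0, p)).1, hmem p⟩,
      (continuous_subtype_val.comp (hH.comp (by fun_prop))).subtype_mk _⟩
  refine ⟨g, ⟨⟨⟨H, hH⟩, fun p => rfl, hone⟩⟩, ?_⟩
  have hg : g.comp (QWinclusion n W) = ContinuousMap.id ↥(QW n W) := by
    ext1 p
    have hrep := (mem_complexify_iff n W _).mp p.2.2
    have hP : complexExtend n P p.1.rep = p.1.rep := by
      ext i
      exact Complex.ext (congrFun (hPid _ hrep.1) i) (congrFun (hPid _ hrep.2) i)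
    have hval := congrArg Subtype.val (hfix 0 (QWinclusion n W p) (by
      change projPath n P 0 p.1.rep = p.1.rep
      simp [projPath, hP]))
    exact Subtype.ext hval
  rw [hg]

end
end

section
/- Let m ≥ 1. The subset {[v] ∈ ℙ(ℝ^{1+m}) : B_{1,m}(v,v) > 0} of the real projective space ℙ(ℝ^{1+m}) (the projectivization of the positive cone of a quadratic form of signature (1,m)), endowed with the subspace topology, is a contractible topological space. -/
open scoped BigOperators

noncomputable section

/-- The standard symmetric bilinear form of signature `(1, m)` on `ℝ^{1+m}`. -/
def B1m (m : ℕ) (x y : Fin (m + 1) → ℝ) : ℝ :=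
  ∑ i : Fin (m + 1), (if (i : ℕ) < 1 then (1 : ℝ) else -1) * x i * y i

namespace B1m

variable {m : ℕ}

theorem self_eq (v : Fin (m + 1) → ℝ) : B1m m v v = v 0 ^ 2 - ∑ i : Fin m, v i.succ ^ 2 := by
  simp [B1m, Fin.sum_univ_succ, pow_two, sub_eq_add_neg]

theorem smul_self (a : ℝ) (v : Fin (m + 1) → ℝ) : B1m m (a • v) (a • v) = a ^ 2 * B1m m v v := by
  simp only [self_eq, Pi.smul_apply, smul_eq_mul, mul_pow, ← Finset.mul_sum]
  ring

theorem continuous_self : Continuous fun v : Fin (m + 1) → ℝ => B1m m v v := by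
  simp only [self_eq]
  fun_prop

theorem apply_zero_ne_zero {v : Fin (m + 1) → ℝ} (hv : 0 < B1m m v v) : v 0 ≠ 0 := by
  intro h
  rw [self_eq, h] at hv
  have : 0 ≤ ∑ i : Fin m, v i.succ ^ 2 := Finset.sum_nonneg fun i _ => sq_nonneg _
  linarith

/-- Positivity of the form at a representative does not depend on the representative. -/
theorem rep_mk_pos_iff (v : Fin (m + 1) → ℝ) (hv : v ≠ 0) :
    0 < B1m m (Projectivization.mk ℝ v hv).rep (Projectivization.mk ℝ v hv).rep ↔
      0 < B1m m v v := by
  obtain ⟨a, ha⟩ := Projectivization.exists_smul_eq_mk_rep ℝ v hv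
  rw [← ha, Units.smul_def, smul_self]
  exact mul_pos_iff_of_pos_left (pow_two_pos_of_ne_zero a.ne_zero)

end B1m

namespace Projectivization

/-- The affine coordinates `vᵢ / v₀` of a point of projective space (junk when `v₀ = 0`). -/
def affineCoord (m : ℕ) : Projectivization ℝ (Fin (m + 1) → ℝ) → Fin m → ℝ :=
  Projectivization.lift (fun v i => v.1 i.succ / v.1 0) <| by
    rintro ⟨_, hv⟩ ⟨w, hw⟩ a rfl
    have ha : a ≠ 0 := by
      rintro rfl
      simp at hv
    ext i
    simp [mul_div_mul_left _ _ ha]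

/-- The point `[1 : x₁ : ⋯ : x_m]` of projective space. -/
def ofAffine {m : ℕ} (x : Fin m → ℝ) : Projectivization ℝ (Fin (m + 1) → ℝ) :=
  mk ℝ (Fin.cons 1 x : Fin (m + 1) → ℝ) fun h => by simpa using congrFun h 0

theorem affineCoord_mk {m : ℕ} (v : Fin (m + 1) → ℝ) (hv : v ≠ 0) :
    affineCoord m (mk ℝ v hv) = fun i => v i.succ / v 0 := rfl

theorem affineCoord_ofAffine {m : ℕ} (x : Fin m → ℝ) : affineCoord m (ofAffine x) = x := by
  ext i
  simp [ofAffine, affineCoord_mk]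

theorem ofAffine_affineCoord_mk {m : ℕ} (v : Fin (m + 1) → ℝ) (hv : v ≠ 0) (h0 : v 0 ≠ 0) :
    ofAffine (affineCoord m (mk ℝ v hv)) = mk ℝ v hv := by
  rw [ofAffine, mk_eq_mk_iff']
  refine ⟨(v 0)⁻¹, ?_⟩
  ext i
  refine Fin.cases ?_ (fun j => ?_) i
  · simp [h0]
  · simp [affineCoord_mk, div_eq_inv_mul]

theorem isQuotientMap_mk' (V : Type*) [AddCommGroup V] [Module ℝ V] [TopologicalSpace V] :
    Topology.IsQuotientMap (mk' ℝ : {v : V // v ≠ 0} → Projectivization ℝ V) :=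
  isQuotientMap_quotient_mk'

theorem continuous_ofAffine {m : ℕ} :
    Continuous (ofAffine : (Fin m → ℝ) → Projectivization ℝ (Fin (m + 1) → ℝ)) := by
  refine (isQuotientMap_mk' _).continuous.comp (Continuous.subtype_mk ?_ _)
  exact continuous_const.finCons continuous_id

theorem rep_ofAffine_pos_iff {m : ℕ} (x : Fin m → ℝ) :
    0 < B1m m (ofAffine x).rep (ofAffine x).rep ↔ ∑ i, x i ^ 2 < 1 := by
  rw [ofAffine, B1m.rep_mk_pos_iff, B1m.self_eq]
  simp

theorem ofAffine_affineCoord {m : ℕ} {p : Projectivization ℝ (Fin (m + 1) → ℝ)}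
    (hp : 0 < B1m m p.rep p.rep) : ofAffine (affineCoord m p) = p := by
  have h := ofAffine_affineCoord_mk p.rep p.rep_nonzero (B1m.apply_zero_ne_zero hp)
  rwa [mk_rep] at h

theorem isOpen_setOf_rep_pos (m : ℕ) :
    IsOpen {p : Projectivization ℝ (Fin (m + 1) → ℝ) | 0 < B1m m p.rep p.rep} := by
  rw [← (isQuotientMap_mk' _).isOpen_preimage]
  simp only [Set.preimage_ofPred_eq, mk'_eq_mk, B1m.rep_mk_pos_iff]
  exact isOpen_lt continuous_const (B1m.continuous_self.comp continuous_subtype_val)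

theorem continuousOn_affineCoord (m : ℕ) :
    ContinuousOn (affineCoord m) {p | 0 < B1m m p.rep p.rep} := by
  rw [(isQuotientMap_mk' _).continuousOn_isOpen_iff (isOpen_setOf_rep_pos m)]
  have hcoord (j : Fin (m + 1)) : Continuous fun v : {v : Fin (m + 1) → ℝ // v ≠ 0} => v.1 j :=
    (continuous_apply j).comp continuous_subtype_val
  refine continuousOn_pi.2 fun i =>
    (hcoord i.succ).continuousOn.div (hcoord 0).continuousOn fun v hv => ?_
  exact B1m.apply_zero_ne_zero ((B1m.rep_mk_pos_iff v.1 v.2).1 hv)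

/-- In affine coordinates, the projectivized positive cone is the open unit ball. -/
def positiveConeHomeomorph (m : ℕ) :
    {p : Projectivization ℝ (Fin (m + 1) → ℝ) | 0 < B1m m p.rep p.rep} ≃ₜ
      {x : Fin m → ℝ | ∑ i, x i ^ 2 < 1} where
  toFun p := ⟨affineCoord m p, (rep_ofAffine_pos_iff _).1 <| by
    rw [ofAffine_affineCoord p.2]; exact p.2⟩
  invFun x := ⟨ofAffine x.1, (rep_ofAffine_pos_iff _).2 x.2⟩
  left_inv p := Subtype.ext (ofAffine_affineCoord p.2)
  right_inv x := Subtype.ext (affineCoord_ofAffine x.1)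
  continuous_toFun := (continuousOn_iff_continuous_domRestrict.1
    (continuousOn_affineCoord m)).subtype_mk _
  continuous_invFun := (continuous_ofAffine.comp continuous_subtype_val).subtype_mk _

end Projectivization

theorem starConvex_setOf_sum_sq_lt_one (m : ℕ) :
    StarConvex ℝ 0 {x : Fin m → ℝ | ∑ i, x i ^ 2 < 1} := by
  rw [starConvex_zero_iff]
  intro x hx a ha0 ha1
  rw [Set.mem_ofPred_eq] at hx ⊢
  refine lt_of_le_of_lt (Finset.sum_le_sum fun i _ => ?_) hx
  rw [Pi.smul_apply, smul_eq_mul, mul_pow]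
  exact mul_le_of_le_one_left (sq_nonneg _) (pow_le_one₀ ha0 ha1)

/-- The projectivization of the positive cone of a quadratic form of
signature `(1, m)`, i.e. the subset `{[v] ∈ ℙ(ℝ^{1+m}) : B(v,v) > 0}` of real projective
space, is contractible. -/
theorem projectivized_positive_cone_contractible (m : ℕ) (hm : 1 ≤ m) :
    ContractibleSpace
      ↥{p : Projectivization ℝ (Fin (m + 1) → ℝ) | 0 < B1m m p.rep p.rep} := by
  have := (starConvex_setOf_sum_sq_lt_one m).contractibleSpace ⟨0, by simp⟩
  exact (Projectivization.positiveConeHomeomorph m).contractibleSpace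

end
end

section
/- Let n ≥ 1. The period domain Ω_{3,n}, with its subspace topology inside ℙ(ℂ^{3+n}), is homotopy equivalent to the complex projective line ℙ(ℂ²) (equivalently, to the 2-sphere). -/
open scoped BigOperators

noncomputable section

open ComplexConjugate unitInterval

namespace Projectivization

variable {K V X : Type*} [DivisionRing K] [AddCommGroup V] [Module K V]

theorem mk_eq_mk_of_eq_smul {t : K} {v w : V} (hv : v ≠ 0) (hw : w ≠ 0) (h : w = t • v) :
    mk K w hw = mk K v hv :=
  (mk_eq_mk_iff' K _ _ _ _).2 ⟨t, h.symm⟩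

variable [TopologicalSpace V] [TopologicalSpace X]

theorem isOpenQuotientMap_mk' [ContinuousConstSMul K V] :
    IsOpenQuotientMap (mk' K : {v : V // v ≠ 0} → Projectivization K V) := by
  refine ⟨Quotient.mk_surjective, continuous_quotient_mk', fun U hU => ?_⟩
  refine isOpen_coinduced.2 ?_
  have key : (mk' K : {v : V // v ≠ 0} → _) ⁻¹' (mk' K '' U) =
      ⋃ t : Kˣ, (fun v : {v : V // v ≠ 0} =>
        (⟨t • (v : V), (smul_ne_zero_iff_ne t).2 v.2⟩ : {v : V // v ≠ 0})) ⁻¹' U := by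
    ext v
    simp only [Set.mem_preimage, Set.mem_image, Set.mem_iUnion]
    constructor
    · rintro ⟨w, hw, hwv⟩
      obtain ⟨t, ht⟩ := (mk_eq_mk_iff K _ _ w.2 v.2).1 hwv
      exact ⟨t, by convert hw⟩
    · rintro ⟨t, ht⟩
      exact ⟨_, ht, (mk_eq_mk_iff K _ _ _ v.2).2 ⟨t, rfl⟩⟩
  change IsOpen ((mk' K : {v : V // v ≠ 0} → _) ⁻¹' (mk' K '' U))
  rw [key]
  refine isOpen_iUnion fun t => hU.preimage ?_
  exact (continuous_subtype_val.const_smul (t : K)).subtype_mk _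

theorem continuous_mk {φ : X → V} (hφ : Continuous φ) (h : ∀ x, φ x ≠ 0) :
    Continuous fun x => mk K (φ x) (h x) :=
  continuous_quotient_mk'.comp (hφ.subtype_mk h)

theorem continuousAt_of_eq_mk [T1Space V] {f : X → Projectivization K V} {φ : X → V}
    (hφ : Continuous φ) (hf : ∀ x (h : φ x ≠ 0), f x = mk K (φ x) h) {x : X} (hx : φ x ≠ 0) :
    ContinuousAt f x := by
  have hU : IsOpen {x | φ x ≠ 0} := isOpen_compl_singleton.preimage hφ
  refine ContinuousOn.continuousAt (s := {x | φ x ≠ 0}) ?_ (hU.mem_nhds hx)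
  rw [continuousOn_iff_continuous_domRestrict]
  have : Set.domRestrict {x | φ x ≠ 0} f = fun x : {x | φ x ≠ 0} => mk K (φ x) x.2 :=
    funext fun x => hf x x.2
  rw [this]
  exact continuous_mk (hφ.comp continuous_subtype_val) _

end Projectivization

open Projectivization

namespace PeriodDomain

variable {n : ℕ}

/-- The vectors representing points of `Omega n`. -/
def IsPeriod (v : Fin (n + 3) → ℂ) : Prop :=
  B3nC n v v = 0 ∧ 0 < (B3nC n v (conjVec n v)).re

/-- The complex quadratic form on the first three coordinates. -/
def headSq (v : Fin (n + 3) → ℂ) : ℂ := v 0 ^ 2 + v 1 ^ 2 + v 2 ^ 2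

/-- The squared Hermitian norm of the first three coordinates. -/
def headNormSq (v : Fin (n + 3) → ℂ) : ℝ :=
  Complex.normSq (v 0) + Complex.normSq (v 1) + Complex.normSq (v 2)

/-- The complex quadratic form on the last `n` coordinates. -/
def tailSq (v : Fin (n + 3) → ℂ) : ℂ := ∑ j : Fin n, v j.succ.succ.succ ^ 2

/-- The squared Hermitian norm of the last `n` coordinates. -/
def tailNormSq (v : Fin (n + 3) → ℂ) : ℝ := ∑ j : Fin n, Complex.normSq (v j.succ.succ.succ)

theorem B3nC_self (v : Fin (n + 3) → ℂ) : B3nC n v v = headSq v - tailSq v := by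
  simp only [B3nC, headSq, tailSq, Fin.sum_univ_succ, Fin.val_succ, Fin.val_zero,
    Fin.succ_zero_eq_one, Fin.succ_one_eq_two]
  simp [add_assoc, sub_eq_add_neg, pow_two]

theorem B3nC_conj_re (v : Fin (n + 3) → ℂ) :
    (B3nC n v (conjVec n v)).re = headNormSq v - tailNormSq v := by
  simp only [B3nC, headNormSq, tailNormSq, conjVec, Fin.sum_univ_succ, Fin.val_succ, Fin.val_zero,
    Fin.succ_zero_eq_one, Fin.succ_one_eq_two]
  simp [add_assoc, sub_eq_add_neg, Complex.normSq_apply]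

theorem isPeriod_iff {v : Fin (n + 3) → ℂ} :
    IsPeriod v ↔ headSq v = tailSq v ∧ tailNormSq v < headNormSq v := by
  rw [IsPeriod, B3nC_self, B3nC_conj_re, sub_eq_zero, sub_pos]

theorem headSq_smul (t : ℂ) (v : Fin (n + 3) → ℂ) : headSq (t • v) = t ^ 2 * headSq v := by
  simp only [headSq, Pi.smul_apply, smul_eq_mul]; ring

theorem headNormSq_smul (t : ℂ) (v : Fin (n + 3) → ℂ) :
    headNormSq (t • v) = Complex.normSq t * headNormSq v := by
  simp only [headNormSq, Pi.smul_apply, smul_eq_mul, map_mul]; ring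

theorem tailSq_smul (t : ℂ) (v : Fin (n + 3) → ℂ) : tailSq (t • v) = t ^ 2 * tailSq v := by
  simp only [tailSq, Pi.smul_apply, smul_eq_mul, mul_pow, Finset.mul_sum]

theorem tailNormSq_smul (t : ℂ) (v : Fin (n + 3) → ℂ) :
    tailNormSq (t • v) = Complex.normSq t * tailNormSq v := by
  simp only [tailNormSq, Pi.smul_apply, smul_eq_mul, map_mul, Finset.mul_sum]

theorem IsPeriod.smul {v : Fin (n + 3) → ℂ} (hv : IsPeriod v) {t : ℂ} (ht : t ≠ 0) :
    IsPeriod (t • v) := by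
  rw [isPeriod_iff] at *
  rw [headSq_smul, tailSq_smul, headNormSq_smul, tailNormSq_smul, hv.1]
  exact ⟨rfl, mul_lt_mul_of_pos_left hv.2 (Complex.normSq_pos.2 ht)⟩

theorem IsPeriod.ne_zero {v : Fin (n + 3) → ℂ} (hv : IsPeriod v) : v ≠ 0 := by
  rintro rfl
  simp [isPeriod_iff, headNormSq, tailNormSq] at hv

theorem mk_mem_Omega {v : Fin (n + 3) → ℂ} (h : v ≠ 0) : mk ℂ v h ∈ Omega n ↔ IsPeriod v := by
  obtain ⟨a, ha⟩ := exists_smul_eq_mk_rep ℂ v h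
  change IsPeriod (mk ℂ v h).rep ↔ _
  rw [← ha]
  refine ⟨fun hp => ?_, fun hp => hp.smul a.ne_zero⟩
  simpa [Units.smul_def, smul_smul] using hp.smul (t := (a : ℂ)⁻¹) (inv_ne_zero a.ne_zero)

theorem norm_tailSq_le (v : Fin (n + 3) → ℂ) : ‖tailSq v‖ ≤ tailNormSq v := by
  refine (norm_sum_le _ _).trans (Finset.sum_le_sum fun j _ => ?_)
  rw [norm_pow, Complex.normSq_eq_norm_sq]

/-- The square root of the discriminant of the equation `headSq (v + z • conj v) = 0` in `z`. -/
def sqrtDisc (v : Fin (n + 3) → ℂ) : ℝ :=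
  √(headNormSq v ^ 2 - Complex.normSq (headSq v))

theorem IsPeriod.headNormSq_pos {v : Fin (n + 3) → ℂ} (hv : IsPeriod v) : 0 < headNormSq v :=
  (Finset.sum_nonneg fun _ _ => Complex.normSq_nonneg _).trans_lt (isPeriod_iff.1 hv).2

theorem IsPeriod.disc_pos {v : Fin (n + 3) → ℂ} (hv : IsPeriod v) :
    0 < headNormSq v ^ 2 - Complex.normSq (headSq v) := by
  rw [Complex.normSq_eq_norm_sq, sub_pos]
  refine pow_lt_pow_left₀ ?_ (norm_nonneg _) two_ne_zero
  rw [(isPeriod_iff.1 hv).1]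
  exact (norm_tailSq_le v).trans_lt (isPeriod_iff.1 hv).2

theorem IsPeriod.sqrtDisc_pos {v : Fin (n + 3) → ℂ} (hv : IsPeriod v) : 0 < sqrtDisc v :=
  Real.sqrt_pos.2 hv.disc_pos

theorem IsPeriod.normSq_headSq {v : Fin (n + 3) → ℂ} (hv : IsPeriod v) :
    Complex.normSq (headSq v) = headNormSq v ^ 2 - sqrtDisc v ^ 2 := by
  rw [sqrtDisc, Real.sq_sqrt hv.disc_pos.le]; ring

theorem sqrtDisc_le (v : Fin (n + 3) → ℂ) : sqrtDisc v ≤ headNormSq v := by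
  have h : 0 ≤ headNormSq v := by
    have := fun i => Complex.normSq_nonneg (v i)
    exact add_nonneg (add_nonneg (this _) (this _)) (this _)
  refine Real.sqrt_le_iff.2 ⟨h, ?_⟩
  linarith [Complex.normSq_nonneg (headSq v)]

theorem sqrtDisc_smul (t : ℂ) (v : Fin (n + 3) → ℂ) :
    sqrtDisc (t • v) = Complex.normSq t * sqrtDisc v := by
  rw [sqrtDisc, sqrtDisc, headNormSq_smul, headSq_smul, map_mul, map_pow,
    show (Complex.normSq t * headNormSq v) ^ 2 - Complex.normSq t ^ 2 * Complex.normSq (headSq v) =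
      Complex.normSq t ^ 2 * (headNormSq v ^ 2 - Complex.normSq (headSq v)) by ring,
    Real.sqrt_mul (sq_nonneg _), Real.sqrt_sq (Complex.normSq_nonneg t)]

/-- The square of the factor by which `flow s` rescales the last `n` coordinates. -/
def tailFactor (s : ℝ) (v : Fin (n + 3) → ℂ) : ℝ :=
  (1 - s) * (headNormSq v + sqrtDisc v) *
    (headNormSq v + sqrtDisc v - s * (headNormSq v - sqrtDisc v))

/-- A deformation of the period vectors that shrinks the last `n` coordinates to zero and
moves the first three coordinates onto the isotropic cone of `headSq`. -/
def flow (s : ℝ) (v : Fin (n + 3) → ℂ) : Fin (n + 3) → ℂ := fun i =>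
  if (i : ℕ) < 3 then
    ((headNormSq v + sqrtDisc v : ℝ) : ℂ) * v i - s * headSq v * conj (v i)
  else (√(tailFactor s v) : ℝ) * v i

theorem continuous_headSq : Continuous (headSq : (Fin (n + 3) → ℂ) → ℂ) := by
  unfold headSq; fun_prop

theorem continuous_headNormSq : Continuous (headNormSq : (Fin (n + 3) → ℂ) → ℝ) := by
  have := Complex.continuous_normSq
  unfold headNormSq; fun_prop

theorem continuous_sqrtDisc : Continuous (sqrtDisc : (Fin (n + 3) → ℂ) → ℝ) :=
  ((continuous_headNormSq.pow 2).sub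
    (Complex.continuous_normSq.comp continuous_headSq)).sqrt

theorem continuous_flow : Continuous fun x : ℝ × (Fin (n + 3) → ℂ) => flow x.1 x.2 := by
  have h₁ := continuous_headSq (n := n)
  have h₂ := continuous_headNormSq (n := n)
  have h₃ := continuous_sqrtDisc (n := n)
  refine continuous_pi fun i => ?_
  by_cases hi : (i : ℕ) < 3
  · simp only [flow, hi, if_true]
    fun_prop
  · simp only [flow, hi, if_false, tailFactor]
    fun_prop

theorem tailFactor_smul (s : ℝ) (t : ℂ) (v : Fin (n + 3) → ℂ) :
    tailFactor s (t • v) = Complex.normSq t ^ 2 * tailFactor s v := by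
  rw [tailFactor, tailFactor, headNormSq_smul, sqrtDisc_smul]; ring

theorem flow_smul (s : ℝ) (t : ℂ) (v : Fin (n + 3) → ℂ) :
    flow s (t • v) = ((Complex.normSq t : ℂ) * t) • flow s v := by
  ext i
  simp only [flow, tailFactor_smul, headNormSq_smul, sqrtDisc_smul, headSq_smul, Pi.smul_apply,
    smul_eq_mul, Real.sqrt_mul (sq_nonneg (Complex.normSq t)),
    Real.sqrt_sq (Complex.normSq_nonneg t), map_mul]
  split_ifs
  · push_cast
    rw [← Complex.mul_conj t]; ring
  · push_cast; ring

theorem flow_zero_apply (s : ℝ) (v : Fin (n + 3) → ℂ) : flow s v 0 =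
    ((headNormSq v + sqrtDisc v : ℝ) : ℂ) * v 0 - s * headSq v * conj (v 0) := by
  simp [flow]

theorem flow_one_apply (s : ℝ) (v : Fin (n + 3) → ℂ) : flow s v 1 =
    ((headNormSq v + sqrtDisc v : ℝ) : ℂ) * v 1 - s * headSq v * conj (v 1) := by
  simp [flow]

theorem flow_two_apply (s : ℝ) (v : Fin (n + 3) → ℂ) : flow s v 2 =
    ((headNormSq v + sqrtDisc v : ℝ) : ℂ) * v 2 - s * headSq v * conj (v 2) := by
  rw [flow, if_pos]
  rw [← Fin.succ_one_eq_two]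
  exact Nat.lt_succ_self 2

theorem flow_tail_apply (s : ℝ) (v : Fin (n + 3) → ℂ) (j : Fin n) :
    flow s v j.succ.succ.succ = (√(tailFactor s v) : ℝ) * v j.succ.succ.succ := by
  simp [flow]

theorem conj_headSq (v : Fin (n + 3) → ℂ) :
    conj (headSq v) = conj (v 0) ^ 2 + conj (v 1) ^ 2 + conj (v 2) ^ 2 := by
  simp [headSq]

theorem ofReal_headNormSq (v : Fin (n + 3) → ℂ) :
    (headNormSq v : ℂ) = v 0 * conj (v 0) + v 1 * conj (v 1) + v 2 * conj (v 2) := by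
  simp [headNormSq, Complex.mul_conj]

theorem headSq_flow {v : Fin (n + 3) → ℂ} (hv : IsPeriod v) (s : ℝ) :
    headSq (flow s v) = tailFactor s v * headSq v := by
  have hc : headSq v * conj (headSq v) = (headNormSq v : ℂ) ^ 2 - (sqrtDisc v : ℂ) ^ 2 := by
    rw [Complex.mul_conj, hv.normSq_headSq]; push_cast; rfl
  have expand : headSq (flow s v) =
      ((headNormSq v + sqrtDisc v : ℝ) : ℂ) ^ 2 * headSq v
        - 2 * s * ((headNormSq v + sqrtDisc v : ℝ) : ℂ) * headSq v * headNormSq v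
        + s ^ 2 * headSq v * (headSq v * conj (headSq v)) := by
    rw [conj_headSq, ofReal_headNormSq]
    conv_lhs => rw [headSq, flow_zero_apply, flow_one_apply, flow_two_apply]
    have hdef : headSq v = v 0 ^ 2 + v 1 ^ 2 + v 2 ^ 2 := rfl
    linear_combination -((headNormSq v + sqrtDisc v : ℝ) : ℂ) ^ 2 * hdef
  rw [expand, hc, tailFactor]
  push_cast
  ring

theorem headNormSq_flow {v : Fin (n + 3) → ℂ} (hv : IsPeriod v) (s : ℝ) :
    headNormSq (flow s v) = tailFactor s v * headNormSq v +
      2 * s * sqrtDisc v ^ 2 * (headNormSq v + sqrtDisc v) := by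
  have expand : headNormSq (flow s v) =
      (headNormSq v + sqrtDisc v) ^ 2 * headNormSq v
        - 2 * s * (headNormSq v + sqrtDisc v) * Complex.normSq (headSq v)
        + s ^ 2 * Complex.normSq (headSq v) * headNormSq v := by
    apply Complex.ofReal_injective
    rw [ofReal_headNormSq, flow_zero_apply, flow_one_apply, flow_two_apply]
    have hdef : headSq v = v 0 ^ 2 + v 1 ^ 2 + v 2 ^ 2 := rfl
    have hnorm := ofReal_headNormSq v
    have hconj := conj_headSq v
    simp only [map_sub, map_add, map_mul, Complex.conj_ofReal, Complex.conj_conj, Complex.ofReal_add,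
      Complex.ofReal_sub, Complex.ofReal_mul, Complex.ofReal_pow, Complex.ofReal_ofNat,
      ← Complex.mul_conj (headSq v)]
    linear_combination
      s * (headNormSq v + sqrtDisc v : ℂ) * conj (headSq v) * hdef +
      s * (headNormSq v + sqrtDisc v : ℂ) * headSq v * hconj -
      ((headNormSq v + sqrtDisc v : ℂ) ^ 2 + s ^ 2 * headSq v * conj (headSq v)) * hnorm
  rw [expand, hv.normSq_headSq, tailFactor]
  ring

theorem IsPeriod.flow {v : Fin (n + 3) → ℂ} (hv : IsPeriod v) {s : ℝ} (h0 : 0 ≤ s) (h1 : s ≤ 1) :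
    IsPeriod (flow s v) := by
  have hh := hv.headNormSq_pos
  have hr := hv.sqrtDisc_pos
  have hrh := sqrtDisc_le v
  have hlast : 0 < headNormSq v + sqrtDisc v - s * (headNormSq v - sqrtDisc v) := by
    nlinarith
  have hk : 0 ≤ tailFactor s v :=
    mul_nonneg (mul_nonneg (by linarith) (by linarith)) hlast.le
  have hsq : tailSq (PeriodDomain.flow s v) = tailFactor s v * tailSq v := by
    simp only [tailSq, flow_tail_apply, mul_pow, Finset.mul_sum, ← Complex.ofReal_pow,
      Real.sq_sqrt hk]
  have hnorm : tailNormSq (PeriodDomain.flow s v) = tailFactor s v * tailNormSq v := by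
    simp only [tailNormSq, flow_tail_apply, map_mul, Finset.mul_sum, Complex.normSq_ofReal,
      Real.mul_self_sqrt hk]
  have hv' := isPeriod_iff.1 hv
  refine isPeriod_iff.2 ⟨?_, ?_⟩
  · rw [headSq_flow hv, hsq, hv'.1]
  · rw [headNormSq_flow hv, hnorm]
    rcases h1.lt_or_eq with h1 | rfl
    · have hk' : 0 < tailFactor s v :=
        mul_pos (mul_pos (by linarith) (by linarith)) hlast
      have : 0 ≤ 2 * s * sqrtDisc v ^ 2 * (headNormSq v + sqrtDisc v) := by positivity
      linarith [mul_lt_mul_of_pos_left hv'.2 hk']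
    · have : 0 < 2 * 1 * sqrtDisc v ^ 2 * (headNormSq v + sqrtDisc v) := by positivity
      have hk0 : tailFactor 1 v = 0 := by simp [tailFactor]
      rw [hk0]; linarith

theorem flow_zero {v : Fin (n + 3) → ℂ} (hv : IsPeriod v) :
    flow 0 v = ((headNormSq v + sqrtDisc v : ℝ) : ℂ) • v := by
  have h : 0 ≤ headNormSq v + sqrtDisc v := (add_pos hv.headNormSq_pos hv.sqrtDisc_pos).le
  ext i
  simp [flow, tailFactor, Real.sqrt_mul_self h]

theorem headSq_flow_one {v : Fin (n + 3) → ℂ} (hv : IsPeriod v) : headSq (flow 1 v) = 0 := by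
  rw [headSq_flow hv]; simp [tailFactor]

theorem flow_one_tail (v : Fin (n + 3) → ℂ) (j : Fin n) : flow 1 v j.succ.succ.succ = 0 := by
  simp [flow_tail_apply, tailFactor]

/-- The parametrization of the isotropic cone of `headSq` by `ℂ²`. -/
def conic (n : ℕ) (a : Fin 2 → ℂ) : Fin (n + 3) → ℂ :=
  Fin.cons (a 0 ^ 2 - a 1 ^ 2) (Fin.cons (Complex.I * (a 0 ^ 2 + a 1 ^ 2))
    (Fin.cons (2 * a 0 * a 1) 0))

theorem conic_zero_apply (a : Fin 2 → ℂ) : conic n a 0 = a 0 ^ 2 - a 1 ^ 2 := rfl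

theorem conic_one_apply (a : Fin 2 → ℂ) :
    conic n a 1 = Complex.I * (a 0 ^ 2 + a 1 ^ 2) := rfl

theorem conic_two_apply (a : Fin 2 → ℂ) : conic n a 2 = 2 * a 0 * a 1 := rfl

theorem conic_tail_apply (a : Fin 2 → ℂ) (j : Fin n) : conic n a j.succ.succ.succ = 0 := rfl

/-- Vectors are equal if the first three coordinates agree and so do the last `n`. -/
theorem vec_ext {v w : Fin (n + 3) → ℂ} (h0 : v 0 = w 0) (h1 : v 1 = w 1) (h2 : v 2 = w 2)
    (h : ∀ j : Fin n, v j.succ.succ.succ = w j.succ.succ.succ) : v = w := by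
  funext i
  refine Fin.cases h0 (fun i => ?_) i
  refine Fin.cases h1 (fun i => ?_) i
  exact Fin.cases h2 h i

theorem continuous_conic : Continuous (conic n) := by
  refine continuous_pi fun i => ?_
  refine Fin.cases ?_ (fun i => ?_) i
  · simp only [conic_zero_apply]; fun_prop
  refine Fin.cases ?_ (fun i => ?_) i
  · simp only [Fin.succ_zero_eq_one, conic_one_apply]; fun_prop
  refine Fin.cases ?_ (fun i => ?_) i
  · simp only [Fin.succ_zero_eq_one, Fin.succ_one_eq_two, conic_two_apply]; fun_prop
  · simp only [conic_tail_apply]; fun_prop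

theorem conic_smul (t : ℂ) (a : Fin 2 → ℂ) : conic n (t • a) = t ^ 2 • conic n a := by
  refine vec_ext ?_ ?_ ?_ fun j => ?_ <;>
  simp only [Pi.smul_apply, smul_eq_mul, conic_zero_apply, conic_one_apply, conic_two_apply,
    conic_tail_apply] <;> ring

theorem headSq_conic (a : Fin 2 → ℂ) : headSq (conic n a) = 0 := by
  simp only [headSq, conic_zero_apply, conic_one_apply, conic_two_apply, mul_pow, Complex.I_sq]
  ring

theorem isPeriod_of_headSq_eq_zero {v : Fin (n + 3) → ℂ} (h : headSq v = 0)
    (ht : ∀ j : Fin n, v j.succ.succ.succ = 0) (hv : v ≠ 0) : IsPeriod v := by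
  refine isPeriod_iff.2 ⟨by simp [h, tailSq, ht], ?_⟩
  simp only [tailNormSq, ht, map_zero, Finset.sum_const_zero]
  have nonneg := fun i => Complex.normSq_nonneg (v i)
  refine lt_of_le_of_ne (add_nonneg (add_nonneg (nonneg _) (nonneg _)) (nonneg _)) fun h0 => hv ?_
  rw [headNormSq] at h0
  have pos := fun i => @Complex.normSq_eq_zero (v i)
  refine vec_ext ((pos _).1 ?_) ((pos _).1 ?_) ((pos _).1 ?_) ht <;>
  linarith [nonneg 0, nonneg 1, nonneg 2]

/-- A vector of `ℂ²` proportional to `a` when the argument is `conic n a`. -/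
def spinorLeft (v : Fin (n + 3) → ℂ) : Fin 2 → ℂ := ![v 0 - Complex.I * v 1, v 2]

/-- Another vector of `ℂ²` proportional to `a` when the argument is `conic n a`. -/
def spinorRight (v : Fin (n + 3) → ℂ) : Fin 2 → ℂ := ![v 2, -v 0 - Complex.I * v 1]

theorem continuous_spinorLeft : Continuous (spinorLeft (n := n)) := by
  unfold spinorLeft; fun_prop

theorem continuous_spinorRight : Continuous (spinorRight (n := n)) := by
  unfold spinorRight; fun_prop

theorem spinorLeft_smul (t : ℂ) (v : Fin (n + 3) → ℂ) :
    spinorLeft (t • v) = t • spinorLeft v := by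
  ext i; fin_cases i <;> simp [spinorLeft]; ring

theorem spinorRight_smul (t : ℂ) (v : Fin (n + 3) → ℂ) :
    spinorRight (t • v) = t • spinorRight v := by
  ext i; fin_cases i <;> simp [spinorRight]; ring

theorem spinorLeft_conic (a : Fin 2 → ℂ) : spinorLeft (conic n a) = (2 * a 0) • a := by
  ext i; fin_cases i <;> simp [spinorLeft, conic_zero_apply, conic_one_apply, conic_two_apply]
  linear_combination -(a 0 ^ 2 + a 1 ^ 2) * Complex.I_sq

theorem spinorRight_conic (a : Fin 2 → ℂ) : spinorRight (conic n a) = (2 * a 1) • a := by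
  ext i; fin_cases i <;> simp [spinorRight, conic_zero_apply, conic_one_apply, conic_two_apply]
  · ring
  linear_combination -(a 0 ^ 2 + a 1 ^ 2) * Complex.I_sq

theorem conic_spinorLeft {v : Fin (n + 3) → ℂ} (h : headSq v = 0)
    (ht : ∀ j : Fin n, v j.succ.succ.succ = 0) :
    conic n (spinorLeft v) = (2 * spinorLeft v 0) • v := by
  rw [headSq] at h
  refine vec_ext ?_ ?_ ?_ fun j => ?_ <;>
  simp [spinorLeft, conic_zero_apply, conic_one_apply, conic_two_apply, conic_tail_apply, ht]
  · linear_combination -h + v 1 ^ 2 * Complex.I_sq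
  · linear_combination Complex.I * h + (Complex.I * v 1 ^ 2 - 2 * v 0 * v 1) * Complex.I_sq

theorem conic_spinorRight {v : Fin (n + 3) → ℂ} (h : headSq v = 0)
    (ht : ∀ j : Fin n, v j.succ.succ.succ = 0) :
    conic n (spinorRight v) = (2 * spinorRight v 1) • v := by
  rw [headSq] at h
  refine vec_ext ?_ ?_ ?_ fun j => ?_ <;>
  simp [spinorRight, conic_zero_apply, conic_one_apply, conic_two_apply, conic_tail_apply, ht]
  · linear_combination h - v 1 ^ 2 * Complex.I_sq
  · linear_combination Complex.I * h + (Complex.I * v 1 ^ 2 + 2 * v 0 * v 1) * Complex.I_sq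
  · ring

theorem spinor_mul_eq {v : Fin (n + 3) → ℂ} (h : headSq v = 0) :
    spinorLeft v 0 * spinorRight v 1 = v 2 ^ 2 := by
  rw [headSq] at h
  simp [spinorLeft, spinorRight]
  linear_combination -h + v 1 ^ 2 * Complex.I_sq

theorem spinorLeft_apply_zero_ne {v : Fin (n + 3) → ℂ} (h : headSq v = 0)
    (hl : spinorLeft v ≠ 0) : spinorLeft v 0 ≠ 0 := by
  intro h0
  have h2 := spinor_mul_eq h
  rw [h0, zero_mul, eq_comm, sq_eq_zero_iff] at h2
  refine hl (funext fun i => ?_)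
  fin_cases i
  exacts [h0, h2]

theorem spinorRight_apply_one_ne {v : Fin (n + 3) → ℂ} (h : headSq v = 0)
    (hr : spinorRight v ≠ 0) : spinorRight v 1 ≠ 0 := by
  intro h0
  have h2 := spinor_mul_eq h
  rw [h0, mul_zero, eq_comm, sq_eq_zero_iff] at h2
  refine hr (funext fun i => ?_)
  fin_cases i
  exacts [h2, h0]

theorem spinor_ne_zero {v : Fin (n + 3) → ℂ} (ht : ∀ j : Fin n, v j.succ.succ.succ = 0)
    (hv : v ≠ 0) : spinorLeft v ≠ 0 ∨ spinorRight v ≠ 0 := by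
  by_contra! h
  have l0 := congrFun h.1 0
  have l1 := congrFun h.1 1
  have r1 := congrFun h.2 1
  simp only [spinorLeft, spinorRight, Matrix.cons_val_zero, Matrix.cons_val_one,
    Pi.zero_apply] at l0 l1 r1
  refine hv (vec_ext ?_ ?_ l1 ht)
  · simp only [Pi.zero_apply]; linear_combination (l0 - r1) / 2
  · simp only [Pi.zero_apply]
    linear_combination Complex.I * (l0 + r1) / 2 + v 1 * Complex.I_sq

open Classical in
/-- The inverse of the parametrization `conic` at the level of projective spaces. -/
def spinorLine (v : Fin (n + 3) → ℂ) : Projectivization ℂ (Fin 2 → ℂ) :=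
  if h : spinorLeft v ≠ 0 then mk ℂ _ h else
    if h : spinorRight v ≠ 0 then mk ℂ _ h else Classical.arbitrary _

theorem spinorLine_eq_left {v : Fin (n + 3) → ℂ} (hl : spinorLeft v ≠ 0) :
    spinorLine v = mk ℂ _ hl := dif_pos hl

theorem spinorLine_eq_right {v : Fin (n + 3) → ℂ} (h : headSq v = 0) (hr : spinorRight v ≠ 0) :
    spinorLine v = mk ℂ _ hr := by
  by_cases hl : spinorLeft v ≠ 0
  · have hp := spinorLeft_apply_zero_ne h hl
    have hq := spinorRight_apply_one_ne h hr
    have hm := spinor_mul_eq h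
    have h2 : v 2 ≠ 0 := fun h2 => mul_ne_zero hp hq (by rw [hm, h2]; ring)
    rw [spinorLine_eq_left hl, mk_eq_mk_iff']
    refine ⟨spinorLeft v 0 / v 2, funext fun i => ?_⟩
    fin_cases i
    · exact div_mul_cancel₀ _ h2
    · change spinorLeft v 0 / v 2 * spinorRight v 1 = v 2
      field_simp
      exact hm
  · rw [spinorLine, dif_neg hl, dif_pos hr]

theorem spinorLine_smul {t : ℂ} (ht : t ≠ 0) (v : Fin (n + 3) → ℂ) :
    spinorLine (t • v) = spinorLine v := by
  by_cases hl : spinorLeft v = 0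
  · by_cases hr : spinorRight v = 0
    · simp [spinorLine, spinorLeft_smul, spinorRight_smul, hl, hr]
    · have hr' : spinorRight (t • v) ≠ 0 := by
        rw [spinorRight_smul]; exact smul_ne_zero ht hr
      have hl' : spinorLeft (t • v) = 0 := by rw [spinorLeft_smul, hl, smul_zero]
      rw [spinorLine, spinorLine, dif_neg (not_not.2 hl), dif_neg (not_not.2 hl'), dif_pos hr,
        dif_pos hr']
      exact mk_eq_mk_of_eq_smul hr hr' (spinorRight_smul t v)
  · have hl' : spinorLeft (t • v) ≠ 0 := by
      rw [spinorLeft_smul]; exact smul_ne_zero ht hl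
    rw [spinorLine_eq_left hl, spinorLine_eq_left hl']
    exact mk_eq_mk_of_eq_smul hl hl' (spinorLeft_smul t v)

theorem spinorLine_conic {a : Fin 2 → ℂ} (ha : a ≠ 0) : spinorLine (conic n a) = mk ℂ a ha := by
  by_cases h0 : a 0 = 0
  · have h1 : a 1 ≠ 0 := fun h1 => ha (by ext i; fin_cases i <;> assumption)
    have h1' : 2 * a 1 ≠ 0 := mul_ne_zero two_ne_zero h1
    have hr : spinorRight (conic n a) ≠ 0 := by
      rw [spinorRight_conic]; exact smul_ne_zero h1' ha
    rw [spinorLine_eq_right (headSq_conic a) hr]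
    exact mk_eq_mk_of_eq_smul ha hr (spinorRight_conic a)
  · have h0' : 2 * a 0 ≠ 0 := mul_ne_zero two_ne_zero h0
    have hl : spinorLeft (conic n a) ≠ 0 := by
      rw [spinorLeft_conic]; exact smul_ne_zero h0' ha
    rw [spinorLine_eq_left hl]
    exact mk_eq_mk_of_eq_smul ha hl (spinorLeft_conic a)

theorem conic_ne_zero {a : Fin 2 → ℂ} (ha : a ≠ 0) : conic n a ≠ 0 := by
  intro h
  refine ha (funext fun i => ?_)
  have hl := spinorLeft_conic (n := n) a
  have hr := spinorRight_conic (n := n) a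
  rw [h] at hl hr
  have hl' := congrFun hl 0
  have hr' := congrFun hr 1
  fin_cases i
  · simpa [spinorLeft] using hl'
  · simpa [spinorRight] using hr'

theorem isPeriod_conic {a : Fin 2 → ℂ} (ha : a ≠ 0) : IsPeriod (conic n a) :=
  isPeriod_of_headSq_eq_zero (headSq_conic a) (conic_tail_apply a) (conic_ne_zero ha)

theorem flow_one_conic (a : Fin 2 → ℂ) :
    flow 1 (conic n a) = ((headNormSq (conic n a) + sqrtDisc (conic n a) : ℝ) : ℂ) • conic n a := by
  refine vec_ext ?_ ?_ ?_ fun j => ?_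
  · simp [flow_zero_apply, headSq_conic]
  · simp [flow_one_apply, headSq_conic]
  · simp [flow_two_apply, headSq_conic]
  · simp [flow_one_tail, conic_tail_apply]

/-- The point of `Omega n` represented by a period vector. -/
def toOmega {v : Fin (n + 3) → ℂ} (hv : IsPeriod v) : Omega n :=
  ⟨mk ℂ v hv.ne_zero, (mk_mem_Omega _).2 hv⟩

theorem toOmega_eq {v w : Fin (n + 3) → ℂ} (hv : IsPeriod v) (hw : IsPeriod w) {t : ℂ}
    (h : w = t • v) : toOmega hw = toOmega hv :=
  Subtype.ext ((mk_eq_mk_iff' ℂ _ _ _ _).2 ⟨t, h.symm⟩)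

theorem isPeriod_rep (p : Omega n) : IsPeriod p.1.rep := p.2

theorem toOmega_rep (p : Omega n) : toOmega (isPeriod_rep p) = p := Subtype.ext (mk_rep _)

theorem continuous_toOmega {X : Type*} [TopologicalSpace X] {φ : X → Fin (n + 3) → ℂ}
    (hφ : Continuous φ) (h : ∀ x, IsPeriod (φ x)) : Continuous fun x => toOmega (h x) :=
  (continuous_mk hφ fun x => (h x).ne_zero).subtype_mk _

theorem isOpenQuotientMap_toOmega :
    IsOpenQuotientMap fun v : {v : Fin (n + 3) → ℂ // IsPeriod v} => toOmega v.2 := by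
  have h := (isOpenQuotientMap_mk' (K := ℂ) (V := Fin (n + 3) → ℂ)).restrictPreimage (Omega n)
  refine ⟨fun p => ⟨⟨_, isPeriod_rep p⟩, toOmega_rep p⟩,
    continuous_toOmega continuous_subtype_val _, fun U hU => ?_⟩
  let e : (mk' ℂ ⁻¹' Omega n : Set {v : Fin (n + 3) → ℂ // v ≠ 0}) →
      {v : Fin (n + 3) → ℂ // IsPeriod v} := fun v => ⟨v.1.1, (mk_mem_Omega v.1.2).1 v.2⟩
  have he : Continuous e := (continuous_subtype_val.comp continuous_subtype_val).subtype_mk _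
  convert h.isOpenMap _ (hU.preimage he) using 1
  ext p
  constructor
  · rintro ⟨v, hv, rfl⟩
    exact ⟨⟨⟨v.1, v.2.ne_zero⟩, (mk_mem_Omega _).2 v.2⟩, hv, rfl⟩
  · rintro ⟨v, hv, rfl⟩
    exact ⟨e v, hv, rfl⟩

theorem exists_smul_eq_rep_toOmega {v : Fin (n + 3) → ℂ} (hv : IsPeriod v) :
    ∃ t : ℂ, t ≠ 0 ∧ (toOmega hv).1.rep = t • v := by
  obtain ⟨a, ha⟩ := exists_smul_eq_mk_rep ℂ v hv.ne_zero
  exact ⟨a, a.ne_zero, ha.symm⟩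

theorem flow_scale_ne_zero {t : ℂ} (ht : t ≠ 0) : (Complex.normSq t : ℂ) * t ≠ 0 :=
  mul_ne_zero (Complex.ofReal_ne_zero.2 (Complex.normSq_pos.2 ht).ne') ht

/-- The retraction of `Omega n` onto the conic, as a map to the projective line. -/
def toLine (p : Omega n) : Projectivization ℂ (Fin 2 → ℂ) := spinorLine (flow 1 p.1.rep)

theorem toLine_toOmega {v : Fin (n + 3) → ℂ} (hv : IsPeriod v) :
    toLine (toOmega hv) = spinorLine (flow 1 v) := by
  obtain ⟨t, ht, h⟩ := exists_smul_eq_rep_toOmega hv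
  rw [toLine, h, flow_smul, spinorLine_smul (flow_scale_ne_zero ht)]

theorem continuous_toLine : Continuous (toLine (n := n)) := by
  rw [← isOpenQuotientMap_toOmega.continuous_comp_iff, continuous_iff_continuousAt]
  intro v
  have hf : Continuous fun v : {v : Fin (n + 3) → ℂ // IsPeriod v} => flow 1 v.1 :=
    continuous_flow.comp (f := fun v : {v : Fin (n + 3) → ℂ // IsPeriod v} => ((1 : ℝ), v.1))
      (continuous_const.prodMk continuous_subtype_val)
  rcases spinor_ne_zero (flow_one_tail v.1) (v.2.flow zero_le_one le_rfl).ne_zero with h | h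
  · refine continuousAt_of_eq_mk (continuous_spinorLeft.comp hf) (fun w hw => ?_) h
    exact (toLine_toOmega w.2).trans (spinorLine_eq_left hw)
  · refine continuousAt_of_eq_mk (continuous_spinorRight.comp hf) (fun w hw => ?_) h
    exact (toLine_toOmega w.2).trans (spinorLine_eq_right (headSq_flow_one w.2) hw)

/-- The embedding of the projective line into `Omega n` as a conic. -/
def ofLine (n : ℕ) (p : Projectivization ℂ (Fin 2 → ℂ)) : Omega n :=
  toOmega (isPeriod_conic p.rep_nonzero)

theorem ofLine_mk {a : Fin 2 → ℂ} (ha : a ≠ 0) :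
    ofLine n (mk ℂ a ha) = toOmega (isPeriod_conic ha) := by
  obtain ⟨t, ht⟩ := exists_smul_eq_mk_rep ℂ a ha
  refine toOmega_eq _ _ (t := (t : ℂ) ^ 2) ?_
  rw [← conic_smul, ← ht, Units.smul_def]

theorem continuous_ofLine : Continuous (ofLine n) := by
  rw [← (isOpenQuotientMap_mk' (K := ℂ)).continuous_comp_iff]
  have : ofLine n ∘ mk' ℂ = fun a => toOmega (isPeriod_conic a.2) :=
    funext fun a => ofLine_mk a.2
  rw [this]
  exact continuous_toOmega (continuous_conic.comp continuous_subtype_val) _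

theorem toLine_ofLine (p : Projectivization ℂ (Fin 2 → ℂ)) : toLine (ofLine n p) = p := by
  induction p with | h a ha =>
  have hp := isPeriod_conic (n := n) ha
  rw [ofLine_mk, toLine_toOmega, flow_one_conic, spinorLine_smul, spinorLine_conic]
  exact Complex.ofReal_ne_zero.2 (add_pos hp.headNormSq_pos hp.sqrtDisc_pos).ne'

theorem ofLine_spinorLine {v : Fin (n + 3) → ℂ} (hv : IsPeriod v) (h : headSq v = 0)
    (ht : ∀ j : Fin n, v j.succ.succ.succ = 0) : ofLine n (spinorLine v) = toOmega hv := by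
  rcases spinor_ne_zero ht hv.ne_zero with hl | hr
  · rw [spinorLine_eq_left hl, ofLine_mk]
    exact toOmega_eq _ _ (conic_spinorLeft h ht)
  · rw [spinorLine_eq_right h hr, ofLine_mk]
    exact toOmega_eq _ _ (conic_spinorRight h ht)

/-- The deformation of `Omega n` onto the conic. -/
def deform (x : I × Omega n) : Omega n :=
  toOmega ((isPeriod_rep x.2).flow x.1.2.1 x.1.2.2)

theorem deform_toOmega (s : I) {v : Fin (n + 3) → ℂ} (hv : IsPeriod v) :
    deform (s, toOmega hv) = toOmega (hv.flow s.2.1 s.2.2) := by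
  obtain ⟨t, -, h⟩ := exists_smul_eq_rep_toOmega hv
  refine toOmega_eq _ _ (t := (Complex.normSq t : ℂ) * t) ?_
  rw [← flow_smul, h]

theorem continuous_deform : Continuous (deform (n := n)) := by
  rw [← ((IsOpenQuotientMap.id (X := I)).prodMap
    isOpenQuotientMap_toOmega).continuous_comp_iff]
  have : deform ∘ Prod.map id (fun v : {v : Fin (n + 3) → ℂ // IsPeriod v} => toOmega v.2) =
      fun x => toOmega (x.2.2.flow x.1.2.1 x.1.2.2) :=
    funext fun x => deform_toOmega x.1 x.2.2
  rw [this]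
  exact continuous_toOmega (continuous_flow.comp
    ((continuous_subtype_val.comp continuous_fst).prodMk
      (continuous_subtype_val.comp continuous_snd))) _

theorem deform_zero (p : Omega n) : deform (0, p) = p := by
  conv_rhs => rw [← toOmega_rep p]
  exact toOmega_eq _ _ (flow_zero (isPeriod_rep p))

theorem deform_one (p : Omega n) : deform (1, p) = ofLine n (toLine p) :=
  (ofLine_spinorLine _ (headSq_flow_one (isPeriod_rep p)) (flow_one_tail _)).symm

end PeriodDomain

open PeriodDomain in
/-- The period domain `Ω_{3,n}` is homotopy equivalent to the
complex projective line `ℙ(ℂ²)`. -/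
theorem Omega_homotopyEquiv_projLine (n : ℕ) (hn : 1 ≤ n) :
    Nonempty (ContinuousMap.HomotopyEquiv ↥(Omega n) (Projectivization ℂ (Fin 2 → ℂ))) := by
  refine ⟨⟨⟨toLine, continuous_toLine⟩, ⟨ofLine n, continuous_ofLine⟩, ?_, ?_⟩⟩
  · exact ContinuousMap.Homotopic.symm
      ⟨⟨⟨deform, continuous_deform⟩, deform_zero, deform_one⟩⟩
  · convert ContinuousMap.Homotopic.refl _
    ext p
    exact (toLine_ofLine p).symm

end
end
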